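/- Product designs give the identity information matrix: if μ is a measure on [0,π] arising (via θ = arccos x) from a quadrature formula of degree 2d with positive weights, and ν is the uniform measure on t ≥ 2d+1 equally spaced angles in (−π,π], then the product design μ ⊗ ν has information matrix M(μ⊗ν) = I_{(d+1)²} in the spherical harmonic regression model of degree d. -/

import Mathlib

open MeasureTheory Real

noncomputable def legendreP (n : ℕ) : Polynomial ℝ :=
  Polynomial.C ((2 ^ n * n.factorial : ℝ))⁻¹ *
    (Polynomial.derivative^[n] ((Polynomial.X ^ 2 - 1) ^ n))

noncomputable def assocP (n m : ℕ) (x : ℝ) : ℝ :=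
  (-1 : ℝ) ^ m * (1 - x ^ 2) ^ ((m : ℝ) / 2) *
    (Polynomial.derivative^[m] (legendreP n)).eval x

noncomputable def sphY (ℓ : ℕ) (m : ℤ) (θ φ : ℝ) : ℝ :=
  if m = 0 then Real.sqrt (2 * ℓ + 1) * assocP ℓ 0 (Real.cos θ)
  else if 0 < m then
    Real.sqrt (2 * (2 * ℓ + 1) * ((ℓ - m.toNat).factorial : ℝ) / ((ℓ + m.toNat).factorial : ℝ)) *
      assocP ℓ m.toNat (Real.cos θ) * Real.cos ((m : ℝ) * φ)
  else
    Real.sqrt (2 * (2 * ℓ + 1) * ((ℓ - (-m).toNat).factorial : ℝ) / ((ℓ + (-m).toNat).factorial : ℝ)) *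
      assocP ℓ (-m).toNat (Real.cos θ) * Real.sin (((-m : ℤ) : ℝ) * φ)

noncomputable def fvec (d : ℕ) (j : Fin ((d + 1) ^ 2)) (θ φ : ℝ) : ℝ :=
  sphY (Nat.sqrt j) ((j : ℤ) - (Nat.sqrt j : ℤ) ^ 2 - (Nat.sqrt j : ℤ)) θ φ

noncomputable def infoMat (d : ℕ) (ξ : Measure (ℝ × ℝ)) :
    Matrix (Fin ((d + 1) ^ 2)) (Fin ((d + 1) ^ 2)) ℝ :=
  fun i j => ∫ z, fvec d i z.1 z.2 * fvec d j z.1 z.2 ∂ξ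

noncomputable def unifSphere : Measure (ℝ × ℝ) :=
  ((volume.restrict (Set.Icc 0 π)).withDensity
      (fun θ => ENNReal.ofReal (Real.sin θ / (4 * π)))).prod
    (volume.restrict (Set.Ioc (-π) π))

namespace PD
open Polynomial

/-- The normalized integral of a polynomial over `[-1,1]`. -/
noncomputable def L (p : ℝ[X]) : ℝ := (1 / 2) * ∫ s in (-1 : ℝ)..1, p.eval s

lemma ii (p : ℝ[X]) : IntervalIntegrable (fun s => p.eval s) volume (-1 : ℝ) 1 :=
  p.continuous.intervalIntegrable _ _

lemma L_add (p q : ℝ[X]) : L (p + q) = L p + L q := by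
  simp only [L, eval_add]
  rw [intervalIntegral.integral_add (ii p) (ii q)]; ring

lemma L_C_mul (c : ℝ) (p : ℝ[X]) : L (C c * p) = c * L p := by
  simp only [L, eval_mul, eval_C]
  rw [intervalIntegral.integral_const_mul]; ring

lemma L_one : L 1 = 1 := by
  simp [L]; norm_num

lemma L_zero : L 0 = 0 := by simp [L]

lemma L_deriv (p : ℝ[X]) : L (derivative p) = (p.eval 1 - p.eval (-1)) / 2 := by
  simp only [L]
  rw [intervalIntegral.integral_eq_sub_of_hasDerivAt (f := fun s => p.eval s)
    (fun s _ => p.hasDerivAt s) (ii _)]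
  ring

lemma L_parts (f g : ℝ[X]) (h : (X ^ 2 - 1 : ℝ[X]) ∣ f * g) :
    L (f * derivative g) = - L (derivative f * g) := by
  obtain ⟨k, hk⟩ := h
  have h1 := L_deriv (f * g)
  rw [derivative_mul, L_add] at h1
  rw [hk] at h1
  simp at h1
  linarith

lemma L_parts_iter (a b : ℕ) (f g : ℝ[X]) (hf : (X ^ 2 - 1 : ℝ[X]) ^ a ∣ f)
    (hg : (X ^ 2 - 1 : ℝ[X]) ^ b ∣ g) (k : ℕ) (hk : k ≤ a + b) :
    L (f * derivative^[a + b] g) =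
      (-1) ^ k * L (derivative^[k] f * derivative^[a + b - k] g) := by
  induction k with
  | zero => simp
  | succ k ih =>
    rw [ih (by omega)]
    have e : a + b - k = (a + b - (k + 1)) + 1 := by omega
    rw [e, Function.iterate_succ_apply', Function.iterate_succ_apply', L_parts]
    · rw [pow_succ]; ring
    · have h1 := pow_sub_dvd_iterate_derivative_of_pow_dvd k hf
      have h2 := pow_sub_dvd_iterate_derivative_of_pow_dvd (a + b - (k + 1)) hg
      by_cases hka : k < a
      · exact Dvd.dvd.mul_right ((dvd_pow_self _ (by omega)).trans h1) _
      · exact Dvd.dvd.mul_left ((dvd_pow_self _ (by omega)).trans h2) _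

lemma L_pow (n : ℕ) : L ((X ^ 2 - 1) ^ n) =
    (-1) ^ n * (2 ^ n * n.factorial) ^ 2 / (2 * n + 1).factorial := by
  induction n with
  | zero => simp [L_one]
  | succ n ih =>
    have h1 := L_deriv (X * (X ^ 2 - 1) ^ (n + 1))
    have h2 : derivative (X * (X ^ 2 - 1 : ℝ[X]) ^ (n + 1)) =
        C (2 * n + 3 : ℝ) * (X ^ 2 - 1) ^ (n + 1) + C (2 * (n + 1) : ℝ) * (X ^ 2 - 1) ^ n := by
      have c2 : (C 2 : ℝ[X]) = 2 := rfl
      have c3 : (C 3 : ℝ[X]) = 3 := rfl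
      simp [derivative_mul, derivative_pow, c2, c3]
      ring
    rw [h2, L_add, L_C_mul, L_C_mul, ih] at h1
    simp at h1
    have h3 : ((2 * (n + 1) + 1).factorial : ℝ) =
        (2 * n + 3) * (2 * n + 2) * (2 * n + 1).factorial := by
      rw [show 2 * (n + 1) + 1 = (2 * n + 1) + 1 + 1 by ring, Nat.factorial_succ,
        Nat.factorial_succ]
      push_cast; ring
    have h4 : ((n + 1).factorial : ℝ) = (n + 1) * n.factorial := by
      rw [Nat.factorial_succ]; push_cast; ring
    have h5 : ((2 * n + 1).factorial : ℝ) ≠ 0 := by positivity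
    have h6 : (2 * n + 3 : ℝ) ≠ 0 := by positivity
    rw [h3, h4]
    have h7 : L ((X ^ 2 - 1) ^ (n + 1)) = - (2 * (n + 1) * ((-1) ^ n *
      (2 ^ n * n.factorial) ^ 2 / (2 * n + 1).factorial)) / (2 * n + 3) := by
      field_simp
      field_simp at h1
      linarith
    rw [h7]
    field_simp
    ring

lemma natDegree_u (n : ℕ) : ((X ^ 2 - 1 : ℝ[X]) ^ n).natDegree = 2 * n := by
  rw [natDegree_pow, show (X ^ 2 - 1 : ℝ[X]) = X ^ 2 - C 1 by simp, natDegree_X_pow_sub_C]; ring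

lemma monic_u : (X ^ 2 - 1 : ℝ[X]).Monic := by
  rw [show (X ^ 2 - 1 : ℝ[X]) = X ^ 2 - C 1 by simp]
  exact monic_X_pow_sub_C 1 two_ne_zero

/-- `(1-x²)^m` as a polynomial. -/
noncomputable def W (m : ℕ) : ℝ[X] := C ((-1) ^ m) * (X ^ 2 - 1) ^ m

lemma natDegree_leg (n : ℕ) : (legendreP n).natDegree ≤ n := by
  rw [legendreP]
  refine (natDegree_C_mul_le _ _).trans ((natDegree_iterate_derivative _ _).trans ?_)
  rw [natDegree_u]; omega

lemma natDegree_dleg (n m : ℕ) : (derivative^[m] (legendreP n)).natDegree ≤ n - m :=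
  (natDegree_iterate_derivative _ _).trans (Nat.sub_le_sub_right (natDegree_leg n) _)

lemma natDegree_Wleg (n m : ℕ) (h : m ≤ n) :
    ((X ^ 2 - 1) ^ m * derivative^[m] (legendreP n)).natDegree ≤ n + m := by
  refine natDegree_mul_le.trans ?_
  have := natDegree_dleg n m
  rw [natDegree_u]; omega

lemma coeff_leg (n : ℕ) : (legendreP n).coeff n =
    (2 ^ n * n.factorial : ℝ)⁻¹ * ((2 * n).factorial / n.factorial) := by
  rw [legendreP, coeff_C_mul, coeff_iterate_derivative]
  have h : ((X ^ 2 - 1 : ℝ[X]) ^ n).coeff (n + n) = 1 := by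
    have := (monic_u.pow n).coeff_natDegree
    rwa [natDegree_u, two_mul] at this
  rw [h, ← two_mul]
  have h2 : ((2 * n).descFactorial n : ℝ) = (2 * n).factorial / n.factorial := by
    rw [eq_div_iff (by positivity)]
    have := Nat.factorial_mul_descFactorial (show n ≤ 2 * n by omega)
    rw [show 2 * n - n = n by omega] at this
    rw [← this]; push_cast; ring
  simp [h2]

lemma coeff_Wleg (n m : ℕ) (h : m ≤ n) :
    ((X ^ 2 - 1) ^ m * derivative^[m] (legendreP n)).coeff (n + m) =
      n.factorial / (n - m).factorial * (legendreP n).coeff n := by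
  have h1 := coeff_mul_add_eq_of_natDegree_le (f := (X ^ 2 - 1 : ℝ[X]) ^ m)
    (g := derivative^[m] (legendreP n)) (natDegree_u m).le (natDegree_dleg n m)
  rw [show n + m = 2 * m + (n - m) by omega, h1]
  have h2 : ((X ^ 2 - 1 : ℝ[X]) ^ m).coeff (2 * m) = 1 := by
    have := (monic_u.pow m).coeff_natDegree
    rwa [natDegree_u] at this
  rw [h2, coeff_iterate_derivative, show n - m + m = n by omega]
  have h3 : (n.descFactorial m : ℝ) = n.factorial / (n - m).factorial := by
    rw [eq_div_iff (by positivity)]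
    have := Nat.factorial_mul_descFactorial h
    rw [← this]; push_cast; ring
  simp [h3]

/-- Integration by parts applied to associated Legendre functions. -/
lemma L_assoc_aux (n n' m : ℕ) :
    L (((X ^ 2 - 1) ^ m * derivative^[m] (legendreP n')) * derivative^[m] (legendreP n)) =
      (2 ^ n * n.factorial : ℝ)⁻¹ * ((-1) ^ (m + n) *
        L (derivative^[m + n] ((X ^ 2 - 1) ^ m * derivative^[m] (legendreP n')) *
          (X ^ 2 - 1) ^ n)) := by
  have h := L_parts_iter m n ((X ^ 2 - 1) ^ m * derivative^[m] (legendreP n')) ((X ^ 2 - 1) ^ n)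
    (dvd_mul_right _ _) dvd_rfl (m + n) le_rfl
  rw [Nat.sub_self, Function.iterate_zero_apply] at h
  rw [← h, ← L_C_mul]
  congr 1
  conv_lhs => rw [legendreP.eq_1 n, iterate_derivative_C_mul, ← Function.iterate_add_apply]
  ring

lemma L_assoc_lt (n n' m : ℕ) (hm : m ≤ n') (h : n' < n) :
    L (((X ^ 2 - 1) ^ m * derivative^[m] (legendreP n')) * derivative^[m] (legendreP n)) = 0 := by
  rw [L_assoc_aux, iterate_derivative_eq_zero]
  · simp [L_zero]
  · have := natDegree_Wleg n' m hm
    omega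

lemma L_assoc_eq (n m : ℕ) (hm : m ≤ n) :
    L (((X ^ 2 - 1) ^ m * derivative^[m] (legendreP n)) * derivative^[m] (legendreP n)) =
      (-1) ^ m * ((n + m).factorial / (n - m).factorial) / (2 * n + 1) := by
  have h1 : derivative^[m + n] ((X ^ 2 - 1) ^ m * derivative^[m] (legendreP n)) =
      C (((m + n).factorial : ℝ) *
        ((X ^ 2 - 1) ^ m * derivative^[m] (legendreP n)).coeff (n + m)) := by
    have hd := natDegree_iterate_derivative ((X ^ 2 - 1) ^ m * derivative^[m] (legendreP n)) (m + n)
    have := natDegree_Wleg n m hm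
    rw [eq_C_of_natDegree_le_zero (hd.trans (by omega)), coeff_iterate_derivative, zero_add,
      Nat.descFactorial_self, nsmul_eq_mul, add_comm n m]
  rw [L_assoc_aux, h1, L_C_mul, coeff_Wleg n m hm, coeff_leg, L_pow, Nat.factorial_succ,
    add_comm n m]
  push_cast
  have h5 : ((2 * n).factorial : ℝ) ≠ 0 := by positivity
  have h6 : (2 * n + 1 : ℝ) ≠ 0 := by positivity
  have h7 : ((-1 : ℝ) ^ n) ^ 2 = 1 := by rw [← pow_mul, mul_comm, pow_mul]; simp
  field_simp
  rw [pow_add, mul_assoc, ← sq, h7, mul_one]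

lemma L_assoc (n n' m : ℕ) (hm : m ≤ n) (hm' : m ≤ n') :
    L (W m * derivative^[m] (legendreP n) * derivative^[m] (legendreP n')) =
      if n = n' then ((n + m).factorial / (n - m).factorial : ℝ) / (2 * n + 1) else 0 := by
  have hs : ((-1 : ℝ) ^ m) * (-1) ^ m = 1 := by rw [← mul_pow]; simp
  rw [W, mul_assoc, mul_assoc, L_C_mul, ← mul_assoc]
  split_ifs with h
  · subst h
    rw [L_assoc_eq n m hm, mul_div_assoc, ← mul_assoc, hs, one_mul]
  · rcases lt_or_gt_of_ne h with h | h
    · rw [L_assoc_lt n' n m hm h, mul_zero]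
    · rw [mul_right_comm, L_assoc_lt n n' m hm' h, mul_zero]

lemma quad {d r : ℕ} (x w : Fin r → ℝ)
    (hq : ∀ ℓ ≤ 2 * d, ∑ l, w l * x l ^ ℓ = (1 / 2) * ∫ s in (-1 : ℝ)..1, s ^ ℓ)
    (p : ℝ[X]) (hp : p.natDegree ≤ 2 * d) : ∑ l, w l * p.eval (x l) = L p := by
  rw [L]
  simp_rw [eval_eq_sum_range' (Nat.lt_succ_of_le hp)]
  rw [intervalIntegral.integral_finsetSum
    (fun i _ => (Continuous.intervalIntegrable (by fun_prop) _ _))]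
  simp_rw [Finset.mul_sum]
  rw [Finset.sum_comm]
  refine Finset.sum_congr rfl fun i hi => ?_
  rw [intervalIntegral.integral_const_mul, mul_left_comm, ← hq i (by simp at hi; omega),
    Finset.mul_sum]
  exact Finset.sum_congr rfl fun l _ => by ring

lemma quad_assoc {d r : ℕ} (x w : Fin r → ℝ) (hx1 : ∀ l, x l ∈ Set.Icc (-1 : ℝ) 1)
    (hq : ∀ ℓ ≤ 2 * d, ∑ l, w l * x l ^ ℓ = (1 / 2) * ∫ s in (-1 : ℝ)..1, s ^ ℓ)
    (n n' m : ℕ) (hm : m ≤ n) (hm' : m ≤ n') (hn : n ≤ d) (hn' : n' ≤ d) :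
    ∑ l, w l * (assocP n m (x l) * assocP n' m (x l)) =
      if n = n' then ((n + m).factorial / (n - m).factorial : ℝ) / (2 * n + 1) else 0 := by
  rw [← L_assoc n n' m hm hm', ← quad x w hq]
  · refine Finset.sum_congr rfl fun l _ => ?_
    congr 1
    obtain ⟨h1, h2⟩ := hx1 l
    have h0 : 0 ≤ 1 - x l ^ 2 := by nlinarith
    have hs : ((-1 : ℝ) ^ m) * (-1) ^ m = 1 := by rw [← mul_pow]; simp
    have hr : ((1 - x l ^ 2) ^ ((m : ℝ) / 2)) * (1 - x l ^ 2) ^ ((m : ℝ) / 2)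
        = (1 - x l ^ 2) ^ m := by
      rw [← Real.rpow_add_of_nonneg h0 (by positivity) (by positivity), add_halves,
        Real.rpow_natCast]
    have hW : (W m).eval (x l) = (1 - x l ^ 2) ^ m := by
      simp [W, ← mul_pow]
    simp only [assocP, eval_mul, hW, ← hr]
    linear_combination (hs) * (((1 - x l ^ 2) ^ ((m : ℝ) / 2)) * (1 - x l ^ 2) ^ ((m : ℝ) / 2)
      * (derivative^[m] (legendreP n)).eval (x l) * (derivative^[m] (legendreP n')).eval (x l))
  · rw [W, mul_assoc, mul_assoc]
    refine (natDegree_C_mul_le _ _).trans ?_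
    rw [← mul_assoc]
    refine natDegree_mul_le.trans ?_
    have := natDegree_Wleg n m hm
    have := natDegree_dleg n' m
    omega

/-- The exponential sum over equally spaced angles. -/
lemma exp_sum (t : ℕ) (α : ℝ) (k : ℤ) (hk : k ≠ 0) (hkt : |k| < t) :
    ∑ j : Fin t, Complex.exp (((k : ℝ) * (α + 2 * π * ((j : ℝ) + 1) / t) : ℝ) * Complex.I) = 0 := by
  have ht : (t : ℂ) ≠ 0 := by
    have : (0 : ℤ) < t := lt_of_le_of_lt (abs_nonneg _) hkt
    exact_mod_cast this.ne'
  set z : ℂ := Complex.exp ((k : ℂ) * (2 * π * Complex.I) / t) with hz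
  have h1 : ∀ j : Fin t, Complex.exp (((k : ℝ) * (α + 2 * π * ((j : ℝ) + 1) / t) : ℝ) * Complex.I)
      = Complex.exp (k * (α + 2 * π / t) * Complex.I) * z ^ (j : ℕ) := by
    intro j
    rw [hz, ← Complex.exp_nat_mul, ← Complex.exp_add]
    congr 1
    push_cast
    field_simp
    ring
  simp_rw [h1]
  rw [← Finset.mul_sum, Fin.sum_univ_eq_sum_range (fun j => z ^ j) t]
  have hz1 : z ≠ 1 := by
    intro h
    obtain ⟨n, hn⟩ := Complex.exp_eq_one_iff.mp h
    have h2 : (2 * π * Complex.I : ℂ) ≠ 0 := Complex.two_pi_I_ne_zero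
    rw [mul_div_right_comm] at hn
    have h3 := mul_right_cancel₀ h2 hn
    rw [div_eq_iff ht] at h3
    have h4 : k = n * t := by exact_mod_cast h3
    have hn0 : n ≠ 0 := by rintro rfl; simp at h4; exact hk h4
    have : (1 : ℤ) ≤ |n| := Int.one_le_abs hn0
    rw [h4, abs_mul, Nat.abs_cast] at hkt
    nlinarith
  have hzt : z ^ t = 1 := by
    rw [hz, ← Complex.exp_nat_mul, mul_div_cancel₀ _ ht]
    exact Complex.exp_int_mul_two_pi_mul_I k
  rw [geom_sum_eq hz1, hzt]; simp

lemma cos_sum (t : ℕ) (α : ℝ) (k : ℤ) (hkt : |k| < t) :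
    ∑ j : Fin t, Real.cos ((k : ℝ) * (α + 2 * π * ((j : ℝ) + 1) / t)) =
      if k = 0 then (t : ℝ) else 0 := by
  split_ifs with hk
  · subst hk; simp
  · have h := congrArg Complex.re (exp_sum t α k hk hkt)
    simpa only [Complex.re_sum, Complex.exp_ofReal_mul_I_re, Complex.zero_re] using h

lemma sin_sum (t : ℕ) (α : ℝ) (k : ℤ) (hkt : |k| < t) :
    ∑ j : Fin t, Real.sin ((k : ℝ) * (α + 2 * π * ((j : ℝ) + 1) / t)) = 0 := by
  by_cases hk : k = 0
  · subst hk; simp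
  · have h := congrArg Complex.im (exp_sum t α k hk hkt)
    simpa only [Complex.im_sum, Complex.exp_ofReal_mul_I_im, Complex.zero_im] using h

/-- The trigonometric factor of the spherical harmonic of order `m`. -/
noncomputable def trig (m : ℤ) (φ : ℝ) : ℝ :=
  if 0 ≤ m then Real.cos (m * φ) else Real.sin (((-m : ℤ) : ℝ) * φ)

lemma trig_sum (d t : ℕ) (ht : 2 * d + 1 ≤ t) (α : ℝ) (m m' : ℤ) (hm : |m| ≤ d) (hm' : |m'| ≤ d) :
    ∑ j : Fin t, trig m (α + 2 * π * ((j : ℝ) + 1) / t) * trig m' (α + 2 * π * ((j : ℝ) + 1) / t)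
      = if m = m' then (if m = 0 then (t : ℝ) else t / 2) else 0 := by
  have ha : |m + m'| < t := by have := abs_add_le m m'; omega
  have hb : |m - m'| < t := by have := abs_sub m m'; omega
  have c1 := cos_sum t α (m + m') ha
  have c2 := cos_sum t α (m - m') hb
  have s1 := sin_sum t α (m + m') ha
  have s2 := sin_sum t α (m - m') hb
  have key : ∀ (f : ℝ → ℝ) (a b : ℝ) (g h : ℝ → ℝ), (∀ φ, f φ = (a * g φ + b * h φ) / 2) →
      ∑ j : Fin t, f (α + 2 * π * ((j : ℝ) + 1) / t) =
        (a * ∑ j : Fin t, g (α + 2 * π * ((j : ℝ) + 1) / t) +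
          b * ∑ j : Fin t, h (α + 2 * π * ((j : ℝ) + 1) / t)) / 2 := by
    intro f a b g h hf
    simp_rw [hf]
    rw [← Finset.sum_div, Finset.sum_add_distrib, Finset.mul_sum, Finset.mul_sum]
  by_cases h : 0 ≤ m <;> by_cases h' : 0 ≤ m'
  · rw [key (fun φ => trig m φ * trig m' φ) 1 1 (fun φ => Real.cos ((m + m' : ℤ) * φ))
      (fun φ => Real.cos ((m - m' : ℤ) * φ)), c1, c2]
    · split_ifs <;> first | omega | ring
    · intro φ
      simp only [trig, h, h', if_true]
      push_cast
      rw [add_mul, sub_mul, Real.cos_add, Real.cos_sub]; ring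
  · rw [key (fun φ => trig m φ * trig m' φ) (-1) 1 (fun φ => Real.sin ((m + m' : ℤ) * φ))
      (fun φ => Real.sin ((m - m' : ℤ) * φ)), s1, s2]
    · split_ifs <;> first | omega | ring
    · intro φ
      simp only [trig, h, h', if_true, if_false]
      push_cast
      rw [add_mul, sub_mul, neg_mul, Real.sin_add, Real.sin_sub, Real.sin_neg]; ring
  · rw [key (fun φ => trig m φ * trig m' φ) (-1) (-1) (fun φ => Real.sin ((m + m' : ℤ) * φ))
      (fun φ => Real.sin ((m - m' : ℤ) * φ)), s1, s2]
    · split_ifs <;> first | omega | ring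
    · intro φ
      simp only [trig, h, h', if_true, if_false]
      push_cast
      rw [add_mul, sub_mul, neg_mul, Real.sin_add, Real.sin_sub, Real.sin_neg]; ring
  · rw [key (fun φ => trig m φ * trig m' φ) (-1) 1 (fun φ => Real.cos ((m + m' : ℤ) * φ))
      (fun φ => Real.cos ((m - m' : ℤ) * φ)), c1, c2]
    · split_ifs <;> first | omega | ring
    · intro φ
      simp only [trig, h, h', if_false]
      push_cast
      rw [add_mul, sub_mul, neg_mul, neg_mul, Real.cos_add, Real.cos_sub, Real.sin_neg,
        Real.sin_neg]; ring

/-- The normalization constant. -/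
noncomputable def N (ℓ : ℕ) (m : ℤ) : ℝ :=
  Real.sqrt ((if m = 0 then 1 else 2) * (2 * ℓ + 1) * ((ℓ - m.natAbs).factorial : ℝ) /
    ((ℓ + m.natAbs).factorial : ℝ))

lemma sphY_eq (ℓ : ℕ) (m : ℤ) (θ φ : ℝ) :
    sphY ℓ m θ φ = N ℓ m * assocP ℓ m.natAbs (Real.cos θ) * trig m φ := by
  unfold sphY N trig
  rcases lt_trichotomy m 0 with h | h | h
  · have e : (-m).toNat = m.natAbs := by omega
    simp only [h.ne, not_lt.mpr h.le, not_le.mpr h, if_false, e]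
  · subst h
    have : ((ℓ.factorial : ℝ)) ≠ 0 := by positivity
    simp [this]
  · have e : m.toNat = m.natAbs := by omega
    simp only [h.ne', h, h.le, if_false, if_true, e]

lemma N_sq (ℓ : ℕ) (m : ℤ) : N ℓ m * N ℓ m =
    (if m = 0 then 1 else 2) * (2 * ℓ + 1) * ((ℓ - m.natAbs).factorial : ℝ) /
    ((ℓ + m.natAbs).factorial : ℝ) := by
  apply Real.mul_self_sqrt
  split_ifs <;> positivity

lemma int_mu {r : ℕ} (x w : Fin r → ℝ) (hw : ∀ l, 0 < w l) (f : ℝ → ℝ) :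
    ∫ θ, f θ ∂(Measure.sum fun l : Fin r =>
            (ENNReal.ofReal (w l)) • Measure.dirac (Real.arccos (x l))) =
      ∑ l, w l * f (Real.arccos (x l)) := by
  rw [Measure.sum_fintype, integral_finsetSum_measure]
  · refine Finset.sum_congr rfl fun l _ => ?_
    rw [integral_smul_measure, integral_dirac, ENNReal.toReal_ofReal (hw l).le, smul_eq_mul]
  · intro l _
    exact (integrable_dirac (by simp)).smul_measure (by simp)

lemma int_nu {t : ℕ} (y : Fin t → ℝ) (f : ℝ → ℝ) :
    ∫ φ, f φ ∂((t : ENNReal)⁻¹ • Measure.sum fun j : Fin t => Measure.dirac (y j)) =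
      (∑ j, f (y j)) / t := by
  rw [integral_smul_measure, Measure.sum_fintype, integral_finsetSum_measure]
  · simp [div_eq_inv_mul]
  · intro l _
    exact integrable_dirac (by simp)

end PD

/-- Product designs give the identity information matrix: if `μ` on `[0,π]` arises via
`θ = arccos x` from a quadrature formula `{xᵢ, wᵢ}` of degree `2d` with positive weights,
and `ν` is uniform on `t ≥ 2d+1` equally spaced angles `φ_j = α + 2πj/t`, then
`M(μ ⊗ ν) = I_{(d+1)²}` in the spherical harmonic regression model of degree `d`. -/
theorem infoMat_product_design (d r t : ℕ) (ht : 2 * d + 1 ≤ t) (α : ℝ)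
    (x : Fin r → ℝ) (hx1 : ∀ l, x l ∈ Set.Icc (-1 : ℝ) 1)
    (w : Fin r → ℝ) (hw : ∀ l, 0 < w l) (hw1 : ∑ l, w l = 1)
    (hq : ∀ ℓ ≤ 2 * d, ∑ l, w l * x l ^ ℓ = (1 / 2) * ∫ s in (-1 : ℝ)..1, s ^ ℓ) :
    infoMat d
        ((Measure.sum fun l : Fin r =>
            (ENNReal.ofReal (w l)) • Measure.dirac (Real.arccos (x l))).prod
          ((t : ENNReal)⁻¹ • Measure.sum fun j : Fin t =>
            Measure.dirac (α + 2 * π * ((j : ℝ) + 1) / t)))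
      = (1 : Matrix (Fin ((d + 1) ^ 2)) (Fin ((d + 1) ^ 2)) ℝ) := by
  ext i j
  rw [Matrix.one_apply]
  unfold infoMat fvec
  obtain ⟨i, hi⟩ := i
  obtain ⟨j, hj⟩ := j
  simp only [Fin.mk.injEq]
  have bound : ∀ k : ℕ, k < (d + 1) ^ 2 → Nat.sqrt k ≤ d ∧
      |(k : ℤ) - (Nat.sqrt k : ℤ) ^ 2 - (Nat.sqrt k : ℤ)| ≤ Nat.sqrt k := by
    intro k hk
    refine ⟨Nat.lt_succ_iff.mp (Nat.sqrt_lt'.mpr hk), ?_⟩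
    have h1 := Nat.sqrt_le k
    have h2 := Nat.sqrt_le_add k
    zify at h1 h2
    rw [abs_le]
    constructor <;> nlinarith
  obtain ⟨hid, him⟩ := bound i hi
  obtain ⟨hjd, hjm⟩ := bound j hj
  have hij : i = j ↔ Nat.sqrt i = Nat.sqrt j ∧
      (i : ℤ) - (Nat.sqrt i : ℤ) ^ 2 - (Nat.sqrt i : ℤ) =
      (j : ℤ) - (Nat.sqrt j : ℤ) ^ 2 - (Nat.sqrt j : ℤ) := by
    constructor
    · rintro rfl; exact ⟨rfl, rfl⟩
    · rintro ⟨h1, h2⟩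
      rw [h1] at h2
      omega
  generalize (i : ℤ) - (Nat.sqrt i : ℤ) ^ 2 - (Nat.sqrt i : ℤ) = m at *
  generalize (j : ℤ) - (Nat.sqrt j : ℤ) ^ 2 - (Nat.sqrt j : ℤ) = m' at *
  generalize Nat.sqrt i = n at *
  generalize Nat.sqrt j = n' at *
  simp only [hij, PD.sphY_eq]
  have e : ∀ z : ℝ × ℝ, PD.N n m * assocP n m.natAbs (Real.cos z.1) * PD.trig m z.2 *
      (PD.N n' m' * assocP n' m'.natAbs (Real.cos z.1) * PD.trig m' z.2) =
      (fun θ => PD.N n m * PD.N n' m' *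
        (assocP n m.natAbs (Real.cos θ) * assocP n' m'.natAbs (Real.cos θ))) z.1 *
      (fun φ => PD.trig m φ * PD.trig m' φ) z.2 := fun z => by ring
  rw [integral_congr_ae (Filter.Eventually.of_forall e), integral_prod_mul
    (fun θ => PD.N n m * PD.N n' m' *
        (assocP n m.natAbs (Real.cos θ) * assocP n' m'.natAbs (Real.cos θ)))
    (fun φ => PD.trig m φ * PD.trig m' φ), PD.int_mu x w hw, PD.int_nu,
    PD.trig_sum d t ht α m m' (by omega) (by omega)]
  have ht0 : (t : ℝ) ≠ 0 := by
    have : t ≠ 0 := by omega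
    exact_mod_cast this
  by_cases hm : m = m'
  · subst hm
    have hc : ∀ l, Real.cos (Real.arccos (x l)) = x l := fun l =>
      Real.cos_arccos (hx1 l).1 (hx1 l).2
    simp only [hc]
    rw [Int.abs_eq_natAbs] at him hjm
    have hq' := PD.quad_assoc x w hx1 hq n n' m.natAbs (by omega) (by omega) hid hjd
    have hs : ∑ l, w l * (PD.N n m * PD.N n' m *
        (assocP n m.natAbs (x l) * assocP n' m.natAbs (x l))) = PD.N n m * PD.N n' m *
        ∑ l, w l * (assocP n m.natAbs (x l) * assocP n' m.natAbs (x l)) := by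
      rw [Finset.mul_sum]
      exact Finset.sum_congr rfl fun l _ => by ring
    rw [hs, hq']
    by_cases hn : n = n'
    · subst hn
      have h6 : (2 * n + 1 : ℝ) ≠ 0 := by positivity
      rw [PD.N_sq]
      simp only [if_true, and_self]
      split_ifs <;> field_simp
    · simp [hn]
  · simp [hm]
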